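/- Let V be a real vector space with a paraquaternionic triple (J₁, J₂, J₃), and let S : V → End_ℝ(V) be an ℝ-linear map admitting a decomposition S_X = S⁰_X + s¹(X)·J₁ + s²(X)·J₂ + s³(X)·J₃ with S⁰_X commuting with each Jₐ. Then the following are equivalent: (i) for every X ∈ V and every J = c₁J₁ + c₂J₂ + c₃J₃ with c₁² + c₂² − c₃² = −1 one has J∘[S_X, J] = [S_{J X}, J]; (ii) s¹(J₁X) = s²(J₂X) = s³(J₃X) for all X ∈ V; (iii) for every X ∈ V and every P = b₁J₁ + b₂J₂ + b₃J₃ with b₁² + b₂² − b₃² = 1 one has P∘[S_X, P] = [S_{P X}, P]. (This is the algebraic core of Proposition 3.2: condition (i) is the coincidence of the almost complex structures I₁^∇ and I₁^{∇'} on the twistor space, and (iii) the coincidence of the almost paracomplex structures P₁^∇ and P₁^{∇'} on the reflector space, for two para-quaternionic connections with difference tensor S.) -/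

import Mathlib

section ParaquaternionicTriple

variable {V : Type*} [AddCommGroup V] [Module ℝ V] {J1 J2 J3 : Module.End ℝ V}

/-- The multiplication table of a paraquaternionic triple follows from `J1 ^ 2 = J2 ^ 2 = 1` and
`J1 * J2 = -J2 * J1 = J3`. -/
theorem paraquaternionic_mul_table (h1 : J1 * J1 = 1) (h2 : J2 * J2 = 1)
    (h12 : J1 * J2 = J3) (h21 : J2 * J1 = -J3) :
    J2 * J3 = -J1 ∧ J3 * J2 = J1 ∧ J1 * J3 = J2 ∧ J3 * J1 = -J2 := by
  refine ⟨?_, ?_, ?_, ?_⟩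
  · rw [← neg_eq_iff_eq_neg.mpr h21, mul_neg, ← mul_assoc, h2, one_mul]
  · rw [← h12, mul_assoc, h2, mul_one]
  · rw [← h12, ← mul_assoc, h1, one_mul]
  · rw [← neg_eq_iff_eq_neg.mpr h21, neg_mul, mul_assoc, h1, mul_one]

/-- On a nontrivial space the members of a paraquaternionic triple are linearly independent. -/
theorem paraquaternionic_combination_eq_zero_iff [Nontrivial V]
    (h1 : J1 * J1 = 1) (h2 : J2 * J2 = 1) (h3 : J3 * J3 = -1)
    (h12 : J1 * J2 = J3) (h21 : J2 * J1 = -J3) (p q r : ℝ) :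
    p • J1 + q • J2 + r • J3 = 0 ↔ p = 0 ∧ q = 0 ∧ r = 0 := by
  obtain ⟨h23, h32, h13, h31⟩ := paraquaternionic_mul_table h1 h2 h12 h21
  refine ⟨fun h => ?_, fun ⟨hp, hq, hr⟩ => by simp [hp, hq, hr]⟩
  have left := congrArg (fun A => J1 * A + A * J1) h
  have mid := congrArg (fun A => J2 * A + A * J2) h
  have right := congrArg (fun A => J3 * A + A * J3) h
  simp only [mul_add, add_mul, mul_smul_comm, smul_mul_assoc, h1, h2, h3, h12, h21, h23, h32,
    h13, h31, mul_zero, zero_mul, add_zero] at left mid right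
  have hp : (2 * p) • (1 : Module.End ℝ V) = 0 := by rw [← left]; module
  have hq : (2 * q) • (1 : Module.End ℝ V) = 0 := by rw [← mid]; module
  have hr : (-2 * r) • (1 : Module.End ℝ V) = 0 := by rw [← right]; module
  simpa using And.intro hp (And.intro hq hr)

/-- The commutator with a combination of the triple only sees the coefficients along the triple. -/
theorem paraquaternionic_commutator (h1 : J1 * J1 = 1) (h2 : J2 * J2 = 1) (h3 : J3 * J3 = -1)
    (h12 : J1 * J2 = J3) (h21 : J2 * J1 = -J3) {A : Module.End ℝ V}
    (hA1 : Commute A J1) (hA2 : Commute A J2) (hA3 : Commute A J3) (a1 a2 a3 c1 c2 c3 : ℝ) :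
    (A + a1 • J1 + a2 • J2 + a3 • J3) * (c1 • J1 + c2 • J2 + c3 • J3)
        - (c1 • J1 + c2 • J2 + c3 • J3) * (A + a1 • J1 + a2 • J2 + a3 • J3) =
      (2 * (a3 * c2 - a2 * c3)) • J1 + (2 * (a1 * c3 - a3 * c1)) • J2
        + (2 * (a1 * c2 - a2 * c1)) • J3 := by
  obtain ⟨h23, h32, h13, h31⟩ := paraquaternionic_mul_table h1 h2 h12 h21
  simp only [mul_add, add_mul, mul_smul_comm, smul_mul_assoc, h1, h2, h3, h12, h21, h23, h32,
    h13, h31, hA1.eq, hA2.eq, hA3.eq]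
  module

/-- For `J = c1 • J1 + c2 • J2 + c3 • J3`, the defect `J * [A + T, J] - [B + T', J]` in terms of
the coefficients `a` of `T` and `d` of `T'`, where `A` and `B` commute with the triple. -/
theorem paraquaternionic_mul_commutator_sub
    (h1 : J1 * J1 = 1) (h2 : J2 * J2 = 1) (h3 : J3 * J3 = -1)
    (h12 : J1 * J2 = J3) (h21 : J2 * J1 = -J3) {A B : Module.End ℝ V}
    (hA1 : Commute A J1) (hA2 : Commute A J2) (hA3 : Commute A J3)
    (hB1 : Commute B J1) (hB2 : Commute B J2) (hB3 : Commute B J3)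
    (a1 a2 a3 d1 d2 d3 c1 c2 c3 : ℝ) :
    (c1 • J1 + c2 • J2 + c3 • J3) *
          ((A + a1 • J1 + a2 • J2 + a3 • J3) * (c1 • J1 + c2 • J2 + c3 • J3)
            - (c1 • J1 + c2 • J2 + c3 • J3) * (A + a1 • J1 + a2 • J2 + a3 • J3))
        - ((B + d1 • J1 + d2 • J2 + d3 • J3) * (c1 • J1 + c2 • J2 + c3 • J3)
            - (c1 • J1 + c2 • J2 + c3 • J3) * (B + d1 • J1 + d2 • J2 + d3 • J3)) =
      (2 * ((c3 * (a1 * c3 - a3 * c1) - c2 * (a1 * c2 - a2 * c1)) - (d3 * c2 - d2 * c3))) • J1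
        + (2 * ((c1 * (a1 * c2 - a2 * c1) - c3 * (a3 * c2 - a2 * c3))
            - (d1 * c3 - d3 * c1))) • J2
        + (2 * ((c1 * (a1 * c3 - a3 * c1) - c2 * (a3 * c2 - a2 * c3))
            - (d1 * c2 - d2 * c1))) • J3 := by
  obtain ⟨h23, h32, h13, h31⟩ := paraquaternionic_mul_table h1 h2 h12 h21
  rw [paraquaternionic_commutator h1 h2 h3 h12 h21 hA1 hA2 hA3,
    paraquaternionic_commutator h1 h2 h3 h12 h21 hB1 hB2 hB3]
  simp only [mul_add, add_mul, mul_smul_comm, smul_mul_assoc, h1, h2, h3, h12, h21, h23, h32,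
    h13, h31]
  module

end ParaquaternionicTriple

/-- Proposition 3.2 (algebraic core): for a paraquaternionic triple `(J₁, J₂, J₃)` on a real
vector space `V` and a linear map `S : V → End ℝ V` decomposing as
`S_X = S⁰_X + s¹(X)J₁ + s²(X)J₂ + s³(X)J₃` with `S⁰_X` commuting with each `Jₐ`,
the following are equivalent:
(i) `J ∘ [S_X, J] = [S_{JX}, J]` for every almost complex structure
`J = c₁J₁ + c₂J₂ + c₃J₃`, `c₁² + c₂² − c₃² = −1`;
(ii) `s¹(J₁X) = s²(J₂X) = s³(J₃X)` for all `X`;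
(iii) `P ∘ [S_X, P] = [S_{PX}, P]` for every almost paracomplex structure
`P = b₁J₁ + b₂J₂ + b₃J₃`, `b₁² + b₂² − b₃² = 1`. -/
theorem twistor_reflector_I1_coincide_iff
    {V : Type*} [AddCommGroup V] [Module ℝ V]
    (J1 J2 J3 : Module.End ℝ V)
    (h1 : J1 * J1 = 1) (h2 : J2 * J2 = 1) (h3 : J3 * J3 = -1)
    (h12 : J1 * J2 = J3) (h21 : J2 * J1 = -J3)
    (S : V →ₗ[ℝ] Module.End ℝ V)
    (S0 : V → Module.End ℝ V) (s1 s2 s3 : V →ₗ[ℝ] ℝ)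
    (hS : ∀ X : V, S X = S0 X + s1 X • J1 + s2 X • J2 + s3 X • J3)
    (hc1 : ∀ X : V, Commute (S0 X) J1) (hc2 : ∀ X : V, Commute (S0 X) J2)
    (hc3 : ∀ X : V, Commute (S0 X) J3) :
    List.TFAE
      [ (∀ (X : V) (J : Module.End ℝ V),
          (∃ c1 c2 c3 : ℝ, c1 ^ 2 + c2 ^ 2 - c3 ^ 2 = -1 ∧
            J = c1 • J1 + c2 • J2 + c3 • J3) →
          J * (S X * J - J * S X) = S (J X) * J - J * S (J X)),
        (∀ X : V, s1 (J1 X) = s2 (J2 X) ∧ s2 (J2 X) = s3 (J3 X)),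
        (∀ (X : V) (P : Module.End ℝ V),
          (∃ b1 b2 b3 : ℝ, b1 ^ 2 + b2 ^ 2 - b3 ^ 2 = 1 ∧
            P = b1 • J1 + b2 • J2 + b3 • J3) →
          P * (S X * P - P * S X) = S (P X) * P - P * S (P X)) ] := by
  obtain ⟨h23, h32, h13, h31⟩ := paraquaternionic_mul_table h1 h2 h12 h21
  cases subsingleton_or_nontrivial V with
  | inl _ =>
    have hsub : ∀ A B : Module.End ℝ V, A = B := fun A B => LinearMap.ext fun _ =>
      Subsingleton.elim _ _
    have hzero : ∀ (s : V →ₗ[ℝ] ℝ) (x : V), s x = 0 := fun s x => by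
      rw [Subsingleton.elim x 0, map_zero]
    tfae_have 1 ↔ 2 := by
      simp only [hzero]
      exact ⟨fun _ _ => by simp, fun _ _ _ _ => hsub _ _⟩
    tfae_have 3 ↔ 2 := by
      simp only [hzero]
      exact ⟨fun _ _ => by simp, fun _ _ _ _ => hsub _ _⟩
    tfae_finish
  | inr _ =>
    have key : ∀ (X : V) (c1 c2 c3 : ℝ) (J : Module.End ℝ V),
        J = c1 • J1 + c2 • J2 + c3 • J3 →
        (J * (S X * J - J * S X) = S (J X) * J - J * S (J X) ↔
          (c3 * (s1 X * c3 - s3 X * c1) - c2 * (s1 X * c2 - s2 X * c1))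
              - ((c1 * s3 (J1 X) + c2 * s3 (J2 X) + c3 * s3 (J3 X)) * c2
                - (c1 * s2 (J1 X) + c2 * s2 (J2 X) + c3 * s2 (J3 X)) * c3) = 0 ∧
          (c1 * (s1 X * c2 - s2 X * c1) - c3 * (s3 X * c2 - s2 X * c3))
              - ((c1 * s1 (J1 X) + c2 * s1 (J2 X) + c3 * s1 (J3 X)) * c3
                - (c1 * s3 (J1 X) + c2 * s3 (J2 X) + c3 * s3 (J3 X)) * c1) = 0 ∧
          (c1 * (s1 X * c3 - s3 X * c1) - c2 * (s3 X * c2 - s2 X * c3))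
              - ((c1 * s1 (J1 X) + c2 * s1 (J2 X) + c3 * s1 (J3 X)) * c2
                - (c1 * s2 (J1 X) + c2 * s2 (J2 X) + c3 * s2 (J3 X)) * c1) = 0) := by
      intro X c1 c2 c3 J hJ
      have hs : ∀ s : V →ₗ[ℝ] ℝ, s (J X) = c1 * s (J1 X) + c2 * s (J2 X) + c3 * s (J3 X) :=
        fun s => by simp [hJ]
      rw [← sub_eq_zero, hS X, hS (J X), hs s1, hs s2, hs s3]
      have hB1 := hc1 (J X)
      have hB2 := hc2 (J X)
      have hB3 := hc3 (J X)
      generalize S0 (J X) = B at hB1 hB2 hB3 ⊢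
      rw [hJ, paraquaternionic_mul_commutator_sub h1 h2 h3 h12 h21 (hc1 X) (hc2 X) (hc3 X)
        hB1 hB2 hB3, paraquaternionic_combination_eq_zero_iff h1 h2 h3 h12 h21]
      simp only [mul_eq_zero, OfNat.ofNat_ne_zero, false_or]
    have sufficient : (∀ X : V, s1 (J1 X) = s2 (J2 X) ∧ s2 (J2 X) = s3 (J3 X)) →
        ∀ (X : V) (c1 c2 c3 : ℝ) (J : Module.End ℝ V), J = c1 • J1 + c2 • J2 + c3 • J3 →
          J * (S X * J - J * S X) = S (J X) * J - J * S (J X) := by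
      intro h X c1 c2 c3 J hJ
      have e12 : ∀ Y, J1 (J2 Y) = J3 Y := fun Y => LinearMap.congr_fun h12 Y
      have e21 : ∀ Y, J2 (J1 Y) = -J3 Y := fun Y => LinearMap.congr_fun h21 Y
      have e13 : ∀ Y, J1 (J3 Y) = J2 Y := fun Y => LinearMap.congr_fun h13 Y
      have e31 : ∀ Y, J3 (J1 Y) = -J2 Y := fun Y => LinearMap.congr_fun h31 Y
      have e23 : ∀ Y, J2 (J3 Y) = -J1 Y := fun Y => LinearMap.congr_fun h23 Y
      have e32 : ∀ Y, J3 (J2 Y) = J1 Y := fun Y => LinearMap.congr_fun h32 Y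
      have e11 : ∀ Y, J1 (J1 Y) = Y := fun Y => LinearMap.congr_fun h1 Y
      have e22 : ∀ Y, J2 (J2 Y) = Y := fun Y => LinearMap.congr_fun h2 Y
      have e33 : ∀ Y, J3 (J3 Y) = -Y := fun Y => LinearMap.congr_fun h3 Y
      have k1 := h (J1 X)
      have k2 := h (J2 X)
      have k3 := h (J3 X)
      simp only [e11, e12, e13, e21, e22, e23, e31, e32, e33, map_neg] at k1 k2 k3
      obtain ⟨p, q⟩ := h X
      have r12 : s1 (J2 X) = -s3 X := by linarith
      have r13 : s1 (J3 X) = s2 X := by linarith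
      have r21 : s2 (J1 X) = s3 X := by linarith
      have r23 : s2 (J3 X) = -s1 X := by linarith
      have r31 : s3 (J1 X) = s2 X := by linarith
      have r32 : s3 (J2 X) = -s1 X := by linarith
      rw [key X c1 c2 c3 J hJ, p, q, r12, r13, r21, r23, r31, r32]
      refine ⟨?_, ?_, ?_⟩ <;> ring
    tfae_have 1 → 2 := by
      intro h X
      have scalars := fun c1 c2 c3 hc => (key X c1 c2 c3 _ rfl).1 (h X _ ⟨c1, c2, c3, hc, rfl⟩)
      have t0 := scalars 0 0 1 (by norm_num)
      have t1 := scalars (3 / 4) 0 (5 / 4) (by norm_num)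
      have t2 := scalars (-3 / 4) 0 (5 / 4) (by norm_num)
      have t3 := scalars 0 (3 / 4) (5 / 4) (by norm_num)
      have t4 := scalars 0 (-3 / 4) (5 / 4) (by norm_num)
      constructor <;> linarith
    tfae_have 3 → 2 := by
      intro h X
      have scalars := fun c1 c2 c3 hc => (key X c1 c2 c3 _ rfl).1 (h X _ ⟨c1, c2, c3, hc, rfl⟩)
      have t1 := scalars (5 / 4) 0 (3 / 4) (by norm_num)
      have t2 := scalars (5 / 4) 0 (-3 / 4) (by norm_num)
      have t3 := scalars 0 (5 / 4) (3 / 4) (by norm_num)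
      have t4 := scalars 0 (5 / 4) (-3 / 4) (by norm_num)
      constructor <;> linarith
    tfae_have 2 → 1 := fun h X J ⟨c1, c2, c3, _, hJ⟩ => sufficient h X c1 c2 c3 J hJ
    tfae_have 2 → 3 := fun h X J ⟨c1, c2, c3, _, hJ⟩ => sufficient h X c1 c2 c3 J hJ
    tfae_finish
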